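/- arXiv:2106.07871 — 2 statements merged into one kernel-verified Lean document; each statement's English description precedes it below -/
import Mathlib

section
/- Let G = (V, E) be a loopless multigraph and let u be any vertex of G. Then the number of spanning trees of G satisfies τ(G) ≤ ∏_{v ∈ V \ {u}} d_G(v), where d_G(v) denotes the degree of v in G. -/
/-- A loopless undirected multigraph with vertex type `V` and edge type `E`:
every edge `e` is assigned an unordered pair `G.inc e` of two *distinct*
endpoints (parallel edges are allowed since `E` is an abstract edge type). -/
structure Multigraph (V : Type) (E : Type) where
  inc : E → Sym2 V
  loopless : ∀ e : E, ¬ (inc e).IsDiag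

namespace Multigraph

variable {V E : Type}

/-- The degree of a vertex `v` in `G`: the number of edges incident with `v`. -/
noncomputable def deg (G : Multigraph V E) (v : V) : ℕ :=
  {e : E | v ∈ G.inc e}.ncard

/-- Adjacency using only edges from the edge set `F`. -/
def AdjOn (G : Multigraph V E) (F : Set E) (a b : V) : Prop :=
  ∃ e ∈ F, G.inc e = s(a, b)

/-- Reachability using only edges from the edge set `F`. -/
def Reach (G : Multigraph V E) (F : Set E) : V → V → Prop :=
  Relation.ReflTransGen (G.AdjOn F)

/-- `(S, F)` is a (sub)tree of `G`: `S` is nonempty, every edge of `F` has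
both endpoints in `S`, the subgraph `(S, F)` is connected, and
`|F| + 1 = |S|` (for a connected subgraph this says exactly that it is
acyclic, i.e. a tree). -/
def IsTree (G : Multigraph V E) (S : Set V) (F : Set E) : Prop :=
  S.Nonempty ∧ (∀ e ∈ F, ∀ v, v ∈ G.inc e → v ∈ S) ∧
    (∀ a ∈ S, ∀ b ∈ S, G.Reach F a b) ∧ F.ncard + 1 = S.ncard

/-- `τ(G)`: the number of spanning trees of `G` (a spanning tree is identified
with its edge set; `τ(G) = 0` when `G` is disconnected). -/
noncomputable def tau (G : Multigraph V E) : ℕ :=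
  {F : Set E | G.IsTree Set.univ F}.ncard

/-- If `u` is reachable from every vertex, some function to `ℕ` strictly decreases along
a suitable edge of `F` at every vertex other than `u`. -/
theorem exists_rank_of_reach (G : Multigraph V E) (F : Set E) (u : V)
    (h : ∀ v, G.Reach F v u) :
    ∃ d : V → ℕ, ∀ v, v ≠ u → ∃ e ∈ F, ∃ w, G.inc e = s(v, w) ∧ d w < d v := by
  classical
  let P : ℕ → V → Prop := fun n =>
    Nat.rec (motive := fun _ => V → Prop) (fun v => v = u)
      (fun _ Q v => ∃ w, G.AdjOn F v w ∧ Q w) n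
  have hP : ∀ v, ∃ n, P n v := fun v => by
    refine Relation.ReflTransGen.head_induction_on (h v) ⟨0, rfl⟩ ?_
    rintro a c hac - ⟨n, hn⟩
    exact ⟨n + 1, c, hac, hn⟩
  refine ⟨fun v => Nat.find (hP v), fun v hv => ?_⟩
  have hs := Nat.find_spec (hP v)
  cases hn : Nat.find (hP v) with
  | zero =>
    rw [hn] at hs
    exact absurd hs hv
  | succ n =>
    rw [hn] at hs
    obtain ⟨w, ⟨e, he, hew⟩, hw⟩ := hs
    exact ⟨e, he, w, hew, (Nat.lt_succ_of_le (Nat.find_min' (hP w) hw)).trans_eq hn.symm⟩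

/-- The edge set of a spanning tree consists of one edge chosen at each vertex other
than `u`. -/
theorem IsTree.exists_range_eq [Finite V] [Finite E] {G : Multigraph V E} {F : Set E}
    (hF : G.IsTree Set.univ F) (u : V) :
    ∃ f : (v : ({u}ᶜ : Set V)) → {e : E | (v : V) ∈ G.inc e},
      Set.range (fun v => (f v : E)) = F := by
  obtain ⟨-, -, hreach, hcard⟩ := hF
  obtain ⟨d, hd⟩ := G.exists_rank_of_reach F u
    fun v => hreach v (Set.mem_univ v) u (Set.mem_univ u)
  choose f hfF w hw hlt using fun v : ({u}ᶜ : Set V) => hd v v.2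
  refine ⟨fun v => ⟨f v, by simp [hw v]⟩, ?_⟩
  have hinj : Function.Injective f := by
    intro a b hab
    have key : s((a : V), w a) = s((b : V), w b) := by rw [← hw a, ← hw b, hab]
    rcases Sym2.eq_iff.1 key with ⟨h, -⟩ | ⟨h₁, h₂⟩
    · exact Subtype.ext h
    · have ha := hlt a
      have hb := hlt b
      rw [h₂, h₁] at ha
      exact absurd ha hb.asymm
  refine Set.eq_of_subset_of_ncard_le (Set.range_subset_iff.2 hfF) ?_ (Set.toFinite F)
  have h₁ : (Set.range f).ncard = ({u}ᶜ : Set V).ncard := by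
    rw [← Set.image_univ, Set.ncard_image_of_injective _ hinj, Set.ncard_univ,
      Nat.card_coe_set_eq]
  have h₂ := Set.ncard_add_ncard_compl ({u} : Set V)
  rw [Set.ncard_singleton] at h₂
  rw [Set.ncard_univ] at hcard
  change F.ncard ≤ (Set.range f).ncard
  omega

/-- **Thomassen's bound**: for a loopless multigraph `G` and any vertex `u`,
`τ(G) ≤ ∏_{v ∈ V \ {u}} d_G(v)`. -/
theorem tau_le_prod_deg {V E : Type} [Fintype V] [Fintype E]
    (G : Multigraph V E) (u : V) :
    G.tau ≤ ∏ᶠ v ∈ ({u}ᶜ : Set V), G.deg v := by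
  classical
  let g : ((v : ({u}ᶜ : Set V)) → {e : E | (v : V) ∈ G.inc e}) → Set E :=
    fun f => Set.range fun v => (f v : E)
  calc
    G.tau ≤ (Set.range g).ncard :=
      Set.ncard_le_ncard (fun F hF => IsTree.exists_range_eq hF u) (Set.toFinite _)
    _ ≤ Nat.card ((v : ({u}ᶜ : Set V)) → {e : E | (v : V) ∈ G.inc e}) := by
      rw [← Set.image_univ, ← Set.ncard_univ]
      exact Set.ncard_image_le Set.finite_univ
    _ = ∏ᶠ v ∈ ({u}ᶜ : Set V), G.deg v := by
      rw [Nat.card_pi, ← finprod_set_coe_eq_finprod_mem, finprod_eq_prod_of_fintype]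
      rfl

end Multigraph
end

section
/- Let G = (V, E) be a loopless multigraph and let u be a vertex of G. Then τ(G) = ∏_{v ∈ V \ {u}} d_G(v) − ∑_{T ∈ NST_u(G)} ∏_{v ∈ V \ V(T)} d_{G − V(T)}(v), where the sum is over all non-spanning subtrees T of G containing u, and d_{G−V(T)}(v) is the degree of v in the induced subgraph G − V(T). -/
namespace Multigraph

variable {V E : Type}

/-- The degree of `v` in the induced subgraph `G − S` (the subgraph of `G`
induced by the complement of the vertex set `S`): the number of edges
incident with `v` none of whose endpoints lies in `S`. -/
noncomputable def degAvoid (G : Multigraph V E) (S : Set V) (v : V) : ℕ :=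
  {e : E | v ∈ G.inc e ∧ ∀ w, w ∈ G.inc e → w ∉ S}.ncard

/-- `NST_u(G)`: the set of non-spanning subtrees of `G` containing `u`,
each subtree given as a pair (vertex set, edge set). -/
def NST (G : Multigraph V E) (u : V) : Set (Set V × Set E) :=
  {p | G.IsTree p.1 p.2 ∧ u ∈ p.1 ∧ p.1 ≠ Set.univ}

/-- `v` points to `w` if the edge chosen at `v` joins `v` to `w`. -/
def Step (G : Multigraph V E) (f : V → Option E) (v w : V) : Prop :=
  ∃ e, f v = some e ∧ G.inc e = s(v, w)

/-- `f` chooses an incident edge at every vertex other than `u`, and no edge at `u`. -/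
def IsChoice (G : Multigraph V E) (u : V) (f : V → Option E) : Prop :=
  f u = none ∧ ∀ v, v ≠ u → ∃ e, v ∈ G.inc e ∧ f v = some e

/-- The vertices from which following the chosen edges leads to `u`. -/
def basin (G : Multigraph V E) (u : V) (f : V → Option E) : Set V :=
  {v | Relation.ReflTransGen (G.Step f) v u}

/-- The edges chosen at the vertices of the basin of `u`. -/
def basinEdges (G : Multigraph V E) (u : V) (f : V → Option E) : Set E :=
  {e | ∃ v ∈ G.basin u f, f v = some e}

variable {G : Multigraph V E} {u : V} {f : V → Option E} {S : Set V} {F : Set E}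

theorem Step.eq {v w w' : V} (h : G.Step f v w) (h' : G.Step f v w') : w = w' := by
  obtain ⟨e, he, hw⟩ := h
  obtain ⟨e', he', hw'⟩ := h'
  obtain rfl : e = e' := Option.some.inj (he.symm.trans he')
  exact Sym2.congr_right.1 (hw.symm.trans hw')

theorem root_mem_basin : u ∈ G.basin u f := Relation.ReflTransGen.refl

theorem Step.mem_basin {v w : V} (h : G.Step f v w) (hw : w ∈ G.basin u f) :
    v ∈ G.basin u f := Relation.ReflTransGen.head h hw

/-- A set of vertices that avoids `u` and in which one can always follow a chosen edge is
disjoint from the basin of `u`. -/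
theorem notMem_of_mem_basin {B : Set V} (hu : u ∉ B) (hB : ∀ x ∈ B, ∃ y ∈ B, G.Step f x y)
    {v : V} (hv : v ∈ G.basin u f) : v ∉ B := by
  induction hv using Relation.ReflTransGen.head_induction_on with
  | refl => exact hu
  | head h _ ih =>
    intro hx
    obtain ⟨y, hy, hs⟩ := hB _ hx
    exact ih (h.eq hs ▸ hy)

theorem IsChoice.mem_inc (hf : G.IsChoice u f) {v : V} {e : E} (h : f v = some e) :
    v ∈ G.inc e := by
  have hv : v ≠ u := by
    rintro rfl
    simp [hf.1] at h
  obtain ⟨e', he', h'⟩ := hf.2 v hv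
  obtain rfl : e = e' := Option.some.inj (h.symm.trans h')
  exact he'

theorem IsChoice.ne_root (hf : G.IsChoice u f) {v : V} {e : E} (h : f v = some e) : v ≠ u := by
  rintro rfl
  simp [hf.1] at h

theorem IsChoice.eq_of_mem_basin (hf : G.IsChoice u f) {v w : V} {e : E}
    (hv : v ∈ G.basin u f) (hve : f v = some e) (hwe : f w = some e) : v = w := by
  by_contra hne
  have he : G.inc e = s(v, w) := (Sym2.mem_and_mem_iff hne).1 ⟨hf.mem_inc hve, hf.mem_inc hwe⟩
  refine notMem_of_mem_basin (B := {v, w}) ?_ ?_ hv (by simp)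
  · rintro (h | h)
    · exact hf.ne_root hve h.symm
    · exact hf.ne_root hwe h.symm
  · rintro x (rfl | rfl)
    · exact ⟨w, by simp, e, hve, he⟩
    · exact ⟨v, by simp, e, hwe, he.trans Sym2.eq_swap⟩

theorem IsChoice.isTree_basin [Finite V] (hf : G.IsChoice u f) :
    G.IsTree (G.basin u f) (G.basinEdges u f) := by
  have hreach : ∀ v ∈ G.basin u f, G.Reach (G.basinEdges u f) v u := by
    intro v hv
    induction hv using Relation.ReflTransGen.head_induction_on with
    | refl => exact Relation.ReflTransGen.refl
    | head h hw ih =>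
      obtain ⟨e, he, hinc⟩ := h
      exact Relation.ReflTransGen.head
        ⟨e, ⟨_, Step.mem_basin ⟨e, he, hinc⟩ hw, he⟩, hinc⟩ ih
  have hsymm : Std.Symm (G.AdjOn (G.basinEdges u f)) :=
    ⟨fun a b ⟨e, he, h⟩ => ⟨e, he, h.trans Sym2.eq_swap⟩⟩
  refine ⟨⟨u, root_mem_basin⟩, ?_, ?_, ?_⟩
  · rintro e ⟨v, hv, hve⟩ w hw
    by_cases hwv : w = v
    · exact hwv ▸ hv
    have hinc : G.inc e = s(v, w) :=
      (Sym2.mem_and_mem_iff (Ne.symm hwv)).1 ⟨hf.mem_inc hve, hw⟩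
    obtain h | ⟨y, hs, hy⟩ := Relation.ReflTransGen.cases_head hv
    · exact absurd h (hf.ne_root hve)
    · exact Step.eq ⟨e, hve, hinc⟩ hs ▸ hy
  · intro a ha b hb
    exact (hreach a ha).trans (Relation.ReflTransGen.stdSymm.symm _ _ (hreach b hb))
  · have himage : some '' G.basinEdges u f = f '' (G.basin u f \ {u}) := by
      ext o
      constructor
      · rintro ⟨e, ⟨v, hv, hve⟩, rfl⟩
        exact ⟨v, ⟨hv, hf.ne_root hve⟩, hve⟩
      · rintro ⟨v, ⟨hv, hvu⟩, rfl⟩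
        obtain ⟨e, -, he⟩ := hf.2 v hvu
        exact ⟨e, ⟨v, hv, he⟩, he.symm⟩
    have hinj : Set.InjOn f (G.basin u f \ {u}) := by
      rintro v ⟨hv, hvu⟩ w - h
      obtain ⟨e, -, he⟩ := hf.2 v hvu
      exact hf.eq_of_mem_basin hv he (h.symm.trans he)
    rw [← Set.ncard_image_of_injective _ (Option.some_injective E), himage,
      hinj.ncard_image]
    exact Set.ncard_sdiff_singleton_add_one root_mem_basin (Set.toFinite _)

/-- A connected edge set admits a choice of edges along which the distance to `u` decreases. -/
theorem exists_parent (hreach : ∀ v ∈ S, G.Reach F v u) :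
    ∃ (p : V → Option E) (d : V → ℕ), p u = none ∧
      ∀ v ∈ S, v ≠ u → ∃ e ∈ F, ∃ w, p v = some e ∧ G.inc e = s(v, w) ∧ d w < d v := by
  classical
  let H : SimpleGraph V := SimpleGraph.fromRel (G.AdjOn F)
  have hH : ∀ {a b : V}, H.Adj a b → G.AdjOn F a b := by
    rintro a b h
    obtain ⟨-, h | ⟨e, he, h⟩⟩ := (SimpleGraph.fromRel_adj _ _ _).1 h
    · exact h
    · exact ⟨e, he, h.trans Sym2.eq_swap⟩
  have hR : ∀ v, G.Reach F v u → H.Reachable v u := by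
    intro v hv
    induction hv using Relation.ReflTransGen.head_induction_on with
    | refl => exact SimpleGraph.Reachable.refl _
    | @head a b h _ ih =>
      have hab : a ≠ b := by
        rintro rfl
        obtain ⟨e, -, he⟩ := h
        exact G.loopless e (by simp [he])
      exact (SimpleGraph.Adj.reachable
        ((SimpleGraph.fromRel_adj _ _ _).2 ⟨hab, Or.inl h⟩)).trans ih
  have hstep : ∀ v, v ∈ S ∧ v ≠ u → ∃ e ∈ F, ∃ w, G.inc e = s(v, w) ∧ H.dist w u < H.dist v u := by
    rintro v ⟨hv, hvu⟩
    obtain ⟨q, hq⟩ := (hR v (hreach v hv)).exists_walk_length_eq_dist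
    cases q with
    | nil => exact absurd rfl hvu
    | @cons _ w _ h q =>
      obtain ⟨e, he, hinc⟩ := hH h
      refine ⟨e, he, w, hinc, ?_⟩
      have := SimpleGraph.dist_le q
      rw [SimpleGraph.Walk.length_cons] at hq
      omega
  choose g hgF w hw hd using hstep
  refine ⟨fun v => if h : v ∈ S ∧ v ≠ u then some (g v h) else none, fun v => H.dist v u,
    by simp, fun v hv hvu => ?_⟩
  exact ⟨g v ⟨hv, hvu⟩, hgF _ _, w v ⟨hv, hvu⟩, by simp [hv, hvu], hw _ _, hd _ _⟩

/-- The choices whose basin is a given tree are those that agree with the orientation of the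
tree towards `u` and that choose, outside of the tree, edges avoiding it. -/
theorem IsTree.exists_choice_iff [Finite V] [Finite E] (hT : G.IsTree S F) (hu : u ∈ S) :
    ∃ p : V → Option E, ∀ f,
      (G.IsChoice u f ∧ G.basin u f = S ∧ G.basinEdges u f = F) ↔
        ∀ v, (v ∈ S → f v = p v) ∧
          (v ∉ S → ∃ e, (v ∈ G.inc e ∧ ∀ w, w ∈ G.inc e → w ∉ S) ∧ f v = some e) := by
  obtain ⟨-, hFS, hconn, hcard⟩ := hT
  obtain ⟨p, d, hpu, hp⟩ := exists_parent (fun v hv => hconn v hv u hu)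
  have hinj : Set.InjOn p (S \ {u}) := by
    rintro v ⟨hv, hvu⟩ w ⟨hw, hwu⟩ h
    by_contra hne
    obtain ⟨e, -, x, hpe, hx, hdx⟩ := hp v hv hvu
    obtain ⟨e', -, y, hpe', hy, hdy⟩ := hp w hw hwu
    obtain rfl : e = e' := Option.some.inj (hpe.symm.trans (h.trans hpe'))
    have h1 := (Sym2.mem_and_mem_iff hne).1
      ⟨hx ▸ Sym2.mem_mk_left v x, hy ▸ Sym2.mem_mk_left w y⟩
    obtain rfl := Sym2.congr_right.1 (hx.symm.trans h1)
    obtain rfl := Sym2.congr_right.1 (hy.symm.trans (h1.trans Sym2.eq_swap))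
    omega
  have himage : p '' (S \ {u}) = some '' F := by
    refine Set.eq_of_subset_of_ncard_le ?_ ?_ (Set.toFinite _)
    · rintro _ ⟨v, ⟨hv, hvu⟩, rfl⟩
      obtain ⟨e, he, -, hpe, -⟩ := hp v hv hvu
      exact ⟨e, he, hpe.symm⟩
    · rw [hinj.ncard_image, Set.ncard_image_of_injective _ (Option.some_injective E)]
      have := Set.ncard_sdiff_singleton_add_one hu (Set.toFinite _)
      omega
  have hsurj : ∀ e ∈ F, ∃ v ∈ S, v ≠ u ∧ p v = some e := by
    intro e he
    obtain ⟨v, ⟨hv, hvu⟩, h⟩ := himage.symm ▸ Set.mem_image_of_mem some he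
    exact ⟨v, hv, hvu, h⟩
  have hinc : ∀ v e, v ∈ S → v ≠ u → p v = some e → v ∈ G.inc e := by
    intro v e hv hvu h
    obtain ⟨e', -, w, h', hw, -⟩ := hp v hv hvu
    obtain rfl : e = e' := Option.some.inj (h.symm.trans h')
    exact hw ▸ Sym2.mem_mk_left v w
  refine ⟨p, fun f => ⟨?_, fun h => ?_⟩⟩
  · rintro ⟨hf, rfl, rfl⟩ v
    constructor
    · intro hv
      by_contra hne
      refine notMem_of_mem_basin (B := {x | x ∈ G.basin u f ∧ f x ≠ p x}) ?_ ?_ hv ⟨hv, hne⟩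
      · rintro ⟨-, h⟩
        exact h (hf.1.trans hpu.symm)
      · rintro x ⟨hx, hxp⟩
        have hxu : x ≠ u := by
          rintro rfl
          exact hxp (hf.1.trans hpu.symm)
        obtain ⟨e, hxe, he⟩ := hf.2 x hxu
        obtain ⟨y, hy, hyu, hye⟩ := hsurj e ⟨x, hx, he⟩
        have hxy : x ≠ y := by
          rintro rfl
          exact hxp (he.trans hye.symm)
        refine ⟨y, ⟨hy, fun h => hxy ?_⟩, e, he,
          (Sym2.mem_and_mem_iff hxy).1 ⟨hxe, hinc y e hy hyu hye⟩⟩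
        exact hf.eq_of_mem_basin hx he (h.trans hye)
    · intro hv
      have hvu : v ≠ u := by
        rintro rfl
        exact hv hu
      obtain ⟨e, hve, he⟩ := hf.2 v hvu
      refine ⟨e, ⟨hve, fun w hw hwS => hv ?_⟩, he⟩
      by_cases hvw : v = w
      · exact hvw ▸ hwS
      · exact Step.mem_basin ⟨e, he, (Sym2.mem_and_mem_iff hvw).1 ⟨hve, hw⟩⟩ hwS
  · have hf : G.IsChoice u f := by
      refine ⟨((h u).1 hu).trans hpu, fun v hvu => ?_⟩
      by_cases hv : v ∈ S
      · obtain ⟨e, -, w, hpe, hw, -⟩ := hp v hv hvu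
        exact ⟨e, hw ▸ Sym2.mem_mk_left v w, ((h v).1 hv).trans hpe⟩
      · obtain ⟨e, he, hfe⟩ := (h v).2 hv
        exact ⟨e, he.1, hfe⟩
    have hsub : ∀ n, ∀ v ∈ S, d v = n → v ∈ G.basin u f := by
      intro n
      induction n using Nat.strong_induction_on with
      | _ n ih =>
        rintro v hv rfl
        by_cases hvu : v = u
        · exact hvu ▸ root_mem_basin
        · obtain ⟨e, he, w, hpe, hw, hd⟩ := hp v hv hvu
          exact Step.mem_basin ⟨e, ((h v).1 hv).trans hpe, hw⟩
            (ih _ hd w (hFS e he w (hw ▸ Sym2.mem_mk_right v w)) rfl)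
    have hbasin : G.basin u f = S := by
      refine Set.Subset.antisymm (fun v hv => ?_) (fun v hv => hsub _ v hv rfl)
      by_contra hvS
      refine notMem_of_mem_basin (B := Sᶜ) (not_not_intro hu) (fun x hx => ?_) hv hvS
      obtain ⟨e, ⟨hxe, he⟩, hfe⟩ := (h x).2 hx
      obtain ⟨y, hy⟩ := Sym2.mem_iff_exists.1 hxe
      exact ⟨y, he y (hy ▸ Sym2.mem_mk_right x y), e, hfe, hy⟩
    refine ⟨hf, hbasin, ?_⟩
    ext e
    constructor
    · rintro ⟨v, hv, hve⟩
      have hvS : v ∈ S := hbasin ▸ hv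
      obtain ⟨e', he', -, hpe, -⟩ := hp v hvS (hf.ne_root hve)
      obtain rfl : e = e' := Option.some.inj (hve.symm.trans (((h v).1 hvS).trans hpe))
      exact he'
    · intro he
      obtain ⟨v, hv, -, hpe⟩ := hsurj e he
      exact ⟨v, hbasin.symm ▸ hv, ((h v).1 hv).trans hpe⟩

theorem ncard_setOf_forall_eq_or_mem [Fintype V] [Finite E] (S : Set V) (p : V → Option E)
    (A : V → Set E) :
    {f : V → Option E | ∀ v, (v ∈ S → f v = p v) ∧ (v ∉ S → ∃ e, e ∈ A v ∧ f v = some e)}.ncard =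
      ∏ᶠ v ∈ Sᶜ, (A v).ncard := by
  classical
  have := Fintype.ofFinite E
  have hset : {f : V → Option E | ∀ v, (v ∈ S → f v = p v) ∧
      (v ∉ S → ∃ e, e ∈ A v ∧ f v = some e)} =
      ↑(Fintype.piFinset fun v => if v ∈ S then {p v} else (A v).toFinset.image some) := by
    ext f
    simp only [Set.mem_ofPred_eq, Finset.mem_coe, Fintype.mem_piFinset]
    refine forall_congr' fun v => ?_
    by_cases hv : v ∈ S <;> simp [hv, eq_comm]
  rw [hset, Set.ncard_coe_finset, Fintype.card_piFinset, finprod_mem_def,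
    finprod_eq_prod_of_fintype]
  refine Finset.prod_congr rfl fun v _ => ?_
  by_cases hv : v ∈ S
  · simp [hv]
  · simp [hv, Finset.card_image_of_injective _ (Option.some_injective E),
      Set.ncard_eq_toFinset_card']

theorem ncard_setOf_isChoice [Fintype V] [Finite E] (G : Multigraph V E) (u : V) :
    {f | G.IsChoice u f}.ncard = ∏ᶠ v ∈ ({u}ᶜ : Set V), G.deg v := by
  refine Eq.trans (congrArg Set.ncard ?_)
    (ncard_setOf_forall_eq_or_mem {u} (fun _ => none) fun v => {e | v ∈ G.inc e})
  ext f
  constructor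
  · rintro ⟨h, h'⟩ v
    exact ⟨fun hv => hv ▸ h, h' v⟩
  · exact fun h => ⟨(h u).1 rfl, fun v => (h v).2⟩

theorem IsTree.ncard_setOf_basin_eq [Fintype V] [Finite E] (hT : G.IsTree S F) (hu : u ∈ S) :
    {f | G.IsChoice u f ∧ G.basin u f = S ∧ G.basinEdges u f = F}.ncard =
      ∏ᶠ v ∈ Sᶜ, G.degAvoid S v := by
  obtain ⟨p, hp⟩ := hT.exists_choice_iff hu
  simp only [hp]
  exact ncard_setOf_forall_eq_or_mem S p fun v => {e | v ∈ G.inc e ∧ ∀ w, w ∈ G.inc e → w ∉ S}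

theorem prod_deg_eq_sum_isTree [Fintype V] [Finite E] (G : Multigraph V E) (u : V) :
    ∏ᶠ v ∈ ({u}ᶜ : Set V), G.deg v =
      ∑ᶠ p ∈ {p : Set V × Set E | G.IsTree p.1 p.2 ∧ u ∈ p.1},
        ∏ᶠ v ∈ p.1ᶜ, G.degAvoid p.1 v := by
  classical
  have := Fintype.ofFinite E
  rw [← ncard_setOf_isChoice, Set.ncard_eq_toFinset_card',
    finsum_mem_eq_finite_toFinset_sum _ (Set.toFinite _),
    Finset.card_eq_sum_card_fiberwise (f := fun f => (G.basin u f, G.basinEdges u f))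
      (t := (Set.toFinite {p : Set V × Set E | G.IsTree p.1 p.2 ∧ u ∈ p.1}).toFinset)]
  · refine Finset.sum_congr rfl fun T hT => ?_
    obtain ⟨hT, hu⟩ := (Set.Finite.mem_toFinset _).1 hT
    rw [← hT.ncard_setOf_basin_eq hu, ← Set.ncard_coe_finset]
    congr 1
    ext f
    simp [Prod.ext_iff]
  · intro f hf
    simpa using ⟨IsChoice.isTree_basin (by simpa using hf), root_mem_basin⟩

theorem sum_isTree_eq_tau_add [Finite V] [Finite E] (G : Multigraph V E) (u : V) :
    ∑ᶠ p ∈ {p : Set V × Set E | G.IsTree p.1 p.2 ∧ u ∈ p.1}, ∏ᶠ v ∈ p.1ᶜ, G.degAvoid p.1 v =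
      G.tau + ∑ᶠ p ∈ G.NST u, ∏ᶠ v ∈ p.1ᶜ, G.degAvoid p.1 v := by
  have hunion : {p : Set V × Set E | G.IsTree p.1 p.2 ∧ u ∈ p.1} =
      Prod.mk Set.univ '' {F | G.IsTree Set.univ F} ∪ G.NST u := by
    ext ⟨S, F⟩
    by_cases hS : S = Set.univ
    · subst hS
      simp [NST]
    · simp [NST, hS, Ne.symm hS]
  have hdisj : Disjoint (Prod.mk Set.univ '' {F | G.IsTree Set.univ F}) (G.NST u) := by
    rw [Set.disjoint_left]
    rintro _ ⟨F, -, rfl⟩ h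
    exact h.2.2 rfl
  rw [hunion, finsum_mem_union hdisj (Set.toFinite _) (Set.toFinite _),
    finsum_mem_image (Prod.mk_right_injective _).injOn]
  congr 1
  rw [finsum_mem_eq_finite_toFinset_sum _ (Set.toFinite _), tau,
    Set.ncard_eq_toFinset_card _ (Set.toFinite _), Finset.card_eq_sum_ones]
  simp

/-- For a loopless multigraph `G` and any vertex `u`,
`τ(G) = ∏_{v ∈ V∖{u}} d_G(v) − ∑_{T ∈ NST_u(G)} ∏_{v ∈ V∖V(T)} d_{G−V(T)}(v)`. -/
theorem tau_eq_prod_deg_sub {V E : Type} [Fintype V] [Fintype E]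
    (G : Multigraph V E) (u : V) :
    (G.tau : ℤ) =
      (∏ᶠ v ∈ ({u}ᶜ : Set V), (G.deg v : ℤ)) -
        ∑ᶠ p ∈ G.NST u, ∏ᶠ v ∈ p.1ᶜ, (G.degAvoid p.1 v : ℤ) := by
  have h : (∏ᶠ v ∈ ({u}ᶜ : Set V), G.deg v) =
      G.tau + ∑ᶠ p ∈ G.NST u, ∏ᶠ v ∈ p.1ᶜ, G.degAvoid p.1 v :=
    (prod_deg_eq_sum_isTree G u).trans (sum_isTree_eq_tau_add G u)
  have hprod : ∀ (S : Set V) (g : V → ℕ),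
      ∏ᶠ v ∈ S, (g v : ℤ) = ((∏ᶠ v ∈ S, g v : ℕ) : ℤ) := fun S g =>
    ((Nat.castRingHom ℤ).toMonoidHom.map_finprod_mem g S.toFinite).symm
  have hsum : ∀ (A : Set (Set V × Set E)) (g : Set V × Set E → ℕ),
      ∑ᶠ p ∈ A, (g p : ℤ) = ((∑ᶠ p ∈ A, g p : ℕ) : ℤ) := fun A g =>
    ((Nat.castAddMonoidHom ℤ).map_finsum_mem g A.toFinite).symm
  simp only [hprod, hsum, h]
  push_cast
  ring

end Multigraph
end
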